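/- arXiv:2402.06891 — 3 statements merged into one kernel-verified Lean document; each statement's English description precedes it below -/
import Mathlib

section
/- Let k ≥ 2 and 1 ≤ i ≤ k-1. With ρ_{2k} : B_{2k} → Aut(F_{2k}) and ρ_k : B_k → Aut(F_k) the Artin-type actions and δ : F_k → F_{2k} the homomorphism with δ(x_i) = y_{2i-1} y_{2i}, one has the intertwining identity ρ_{2k}(σ_{2i} σ_{2i+1} σ_{2i-1} σ_{2i})(δ(w)) = δ(ρ_k(σ_i)(w)) for every w ∈ F_k. In other words, the braid σ_{2i} σ_{2i+1} σ_{2i-1} σ_{2i} ∈ B_{2k}, which swaps the i-th and (i+1)-st adjacent pairs of strands as blocks, acts on the image of δ exactly as the generator σ_i ∈ B_k acts on F_k. -/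
/-- Braid relations on `m` generators (0-indexed). -/
def braidRels (m : ℕ) : Set (FreeGroup (Fin m)) :=
  { r | (∃ i j : Fin m, (i : ℕ) + 1 = (j : ℕ) ∧
          r = FreeGroup.of i * FreeGroup.of j * FreeGroup.of i *
              (FreeGroup.of j * FreeGroup.of i * FreeGroup.of j)⁻¹) ∨
        (∃ i j : Fin m, (i : ℕ) + 2 ≤ (j : ℕ) ∧
          r = FreeGroup.of i * FreeGroup.of j * (FreeGroup.of j * FreeGroup.of i)⁻¹) }

/-- The braid group on `n` strands, with generators `σ_1, …, σ_{n-1}`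
(0-indexed as `Fin (n-1)`). -/
def BraidGroup (n : ℕ) : Type := PresentedGroup (braidRels (n - 1))

noncomputable instance (n : ℕ) : Group (BraidGroup n) := by
  unfold BraidGroup; infer_instance

/-- The generator `σ_{i+1}` (1-indexed), i.e. the 0-indexed generator `i`. -/
def braidGen {n : ℕ} (i : Fin (n - 1)) : BraidGroup n := PresentedGroup.of i

/-- The Artin automorphism `β_{i+1}` (1-indexed) of the free group on `n` generators:
(0-indexed) `y_i ↦ y_{i+1}`, `y_{i+1} ↦ y_{i+1}⁻¹ y_i y_{i+1}`, other generators fixed. -/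
def artinMap (n i : ℕ) (h : i + 1 < n) : FreeGroup (Fin n) →* FreeGroup (Fin n) :=
  FreeGroup.lift (fun j : Fin n =>
    if (j : ℕ) = i then FreeGroup.of ⟨i + 1, h⟩
    else if (j : ℕ) = i + 1 then
      (FreeGroup.of ⟨i + 1, h⟩)⁻¹ * FreeGroup.of ⟨i, by omega⟩ * FreeGroup.of ⟨i + 1, h⟩
    else FreeGroup.of j)

/-- The homomorphism `δ : F_k → F_{2k}` with `δ(x_i) = y_{2i-1} y_{2i}` (1-indexed). -/
def platDelta (k : ℕ) : FreeGroup (Fin k) →* FreeGroup (Fin (2 * k)) :=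
  FreeGroup.lift (fun i : Fin k =>
    FreeGroup.of ⟨2 * (i : ℕ), by have := i.isLt; omega⟩ *
    FreeGroup.of ⟨2 * (i : ℕ) + 1, by have := i.isLt; omega⟩)

open FreeGroup (of)

theorem artinMap_of_left {n i : ℕ} (h : i + 1 < n) :
    artinMap n i h (of ⟨i, by omega⟩) = of ⟨i + 1, h⟩ := by
  simp [artinMap]

theorem artinMap_of_right {n i : ℕ} (h : i + 1 < n) :
    artinMap n i h (of ⟨i + 1, h⟩) =
      (of ⟨i + 1, h⟩)⁻¹ * of ⟨i, by omega⟩ * of ⟨i + 1, h⟩ := by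
  simp [artinMap]

theorem artinMap_of_ne {n i : ℕ} (h : i + 1 < n) {j : Fin n} (h₀ : (j : ℕ) ≠ i)
    (h₁ : (j : ℕ) ≠ i + 1) : artinMap n i h (of j) = of j := by
  simp [artinMap, h₀, h₁]

theorem platDelta_of {k : ℕ} (j : Fin k) :
    platDelta k (of j) = of ⟨2 * j, by omega⟩ * of ⟨2 * j + 1, by omega⟩ := by
  simp [platDelta]

/-- The automorphism induced by swapping two adjacent pairs of strands, the first of which starts
at position `p`. -/
def blockSwapMap (n p : ℕ) (h : p + 3 < n) : FreeGroup (Fin n) →* FreeGroup (Fin n) :=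
  (artinMap n (p + 1) (by omega)).comp ((artinMap n (p + 2) h).comp
    ((artinMap n p (by omega)).comp (artinMap n (p + 1) (by omega))))

theorem blockSwapMap_left {n p : ℕ} (h : p + 3 < n) :
    blockSwapMap n p h (of ⟨p, by omega⟩ * of ⟨p + 1, by omega⟩) =
      of ⟨p + 2, by omega⟩ * of ⟨p + 3, h⟩ := by
  simp [blockSwapMap, artinMap, show p ≠ p + 1 + 1 by omega, show p + 2 ≠ p by omega]

theorem blockSwapMap_right {n p : ℕ} (h : p + 3 < n) :
    blockSwapMap n p h (of ⟨p + 2, by omega⟩ * of ⟨p + 3, h⟩) =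
      (of ⟨p + 2, by omega⟩ * of ⟨p + 3, h⟩)⁻¹ *
        (of ⟨p, by omega⟩ * of ⟨p + 1, by omega⟩) * (of ⟨p + 2, by omega⟩ * of ⟨p + 3, h⟩) := by
  simp [blockSwapMap, artinMap, show p ≠ p + 1 + 1 by omega, show p ≠ p + 2 + 1 by omega,
    show p + 2 ≠ p by omega]
  group

theorem blockSwapMap_of_ne {n p : ℕ} (h : p + 3 < n) {j : Fin n}
    (hj : (j : ℕ) < p ∨ p + 3 < j) : blockSwapMap n p h (of j) = of j := by
  simp only [blockSwapMap, MonoidHom.comp_apply]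
  iterate 4 rw [artinMap_of_ne _ (by omega) (by omega)]

theorem blockSwapMap_comp_platDelta {k m : ℕ} (h : m + 1 < k) :
    (blockSwapMap (2 * k) (2 * m) (by omega)).comp (platDelta k) =
      (platDelta k).comp (artinMap k m h) := by
  ext j
  simp only [MonoidHom.comp_apply]
  obtain ⟨j, hj⟩ := j
  by_cases h₀ : j = m
  · subst h₀
    rw [artinMap_of_left, platDelta_of, platDelta_of]
    exact blockSwapMap_left _
  by_cases h₁ : j = m + 1
  · subst h₁
    rw [artinMap_of_right]
    simp only [map_mul (platDelta k), map_inv, platDelta_of]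
    exact blockSwapMap_right _
  · rw [artinMap_of_ne h h₀ h₁, platDelta_of, map_mul,
      blockSwapMap_of_ne _ (by simp only; omega), blockSwapMap_of_ne _ (by simp only; omega)]

/-- Intertwining identity (move P2, Figure 24): the braid
`σ_{2i} σ_{2i+1} σ_{2i-1} σ_{2i} ∈ B_{2k}` (1-indexed, `1 ≤ i ≤ k-1`) acts on the image
of `δ` exactly as the generator `σ_i ∈ B_k` acts on `F_k`:
`ρ_{2k}(σ_{2i} σ_{2i+1} σ_{2i-1} σ_{2i})(δ(w)) = δ(ρ_k(σ_i)(w))`. -/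
theorem block_transposition_intertwines_delta (k : ℕ) (hk : 2 ≤ k)
    (i : ℕ) (hi1 : 1 ≤ i) (hi2 : i ≤ k - 1)
    (ρ₂ : BraidGroup (2 * k) →* MulAut (FreeGroup (Fin (2 * k))))
    (hρ₂ : ∀ (a : Fin (2 * k - 1)) (g : FreeGroup (Fin (2 * k))),
      ρ₂ (braidGen a) g = artinMap (2 * k) a (by have := a.isLt; omega) g)
    (ρ₁ : BraidGroup k →* MulAut (FreeGroup (Fin k)))
    (hρ₁ : ∀ (a : Fin (k - 1)) (g : FreeGroup (Fin k)),
      ρ₁ (braidGen a) g = artinMap k a (by have := a.isLt; omega) g)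
    (w : FreeGroup (Fin k)) :
    ρ₂ (braidGen ⟨2 * i - 1, by omega⟩ * braidGen ⟨2 * i, by omega⟩ *
        braidGen ⟨2 * i - 2, by omega⟩ * braidGen ⟨2 * i - 1, by omega⟩)
      (platDelta k w)
      = platDelta k (ρ₁ (braidGen ⟨i - 1, by omega⟩) w) := by
  obtain ⟨m, rfl⟩ : ∃ m, i = m + 1 := ⟨i - 1, by omega⟩
  simp only [map_mul, MulAut.mul_apply, hρ₂, hρ₁]
  exact DFunLike.congr_fun (blockSwapMap_comp_platDelta (m := m) (by omega)) w
end

section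
/- (Lemma 2.2 of the paper.) Consider the disjoint union ⨆_{k ≥ 1} B_{2k} and let ≈ be the equivalence relation on it generated by the following moves: (M2) for b ∈ B_{2k} and 1 ≤ i ≤ k-1, b ≈ (σ_{2i} σ_{2i+1} σ_{2i-1} σ_{2i}) b and b ≈ b (σ_{2i} σ_{2i+1} σ_{2i-1} σ_{2i}); (M6') for b ∈ B_{2k}, b ≈ ι(b) σ_{2k}, where ι : B_{2k} → B_{2k+2} is the standard inclusion homomorphism (σ_i ↦ σ_i). Then for every b ∈ B_{2k} and every 1 ≤ j ≤ k, the element T_j(b) σ_{2j} ∈ B_{2k+2} satisfies T_j(b) σ_{2j} ≈ b; that is, Birman's move M6 is a consequence of the moves M6' and M2. -/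
/-- The assignment on generators of the stabilization map
`T_j : B_{2k} → B_{2k+2}` (1-indexed, `1 ≤ j ≤ k`): the 1-indexed generator
`σ_{a+1}` (so `a : Fin (2k-1)` is 0-indexed) is sent to `σ_{a+1}` if `a+1 < 2j`, to
`σ_{2j} σ_{2j+1} σ_{2j+2} σ_{2j+1}⁻¹ σ_{2j}⁻¹` if `a+1 = 2j`, and to `σ_{a+3}` if
`a+1 > 2j`. -/
noncomputable def TjGen (k j : ℕ) (a : Fin (2 * k - 1)) : BraidGroup (2 * k + 2) :=
  if _ : (a : ℕ) + 1 < 2 * j then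
    braidGen (n := 2 * k + 2) ⟨(a : ℕ), by have := a.isLt; omega⟩
  else if _ : (a : ℕ) + 1 = 2 * j then
    braidGen (n := 2 * k + 2) ⟨(a : ℕ), by have := a.isLt; omega⟩ *
    braidGen (n := 2 * k + 2) ⟨(a : ℕ) + 1, by have := a.isLt; omega⟩ *
    braidGen (n := 2 * k + 2) ⟨(a : ℕ) + 2, by have := a.isLt; omega⟩ *
    (braidGen (n := 2 * k + 2) ⟨(a : ℕ) + 1, by have := a.isLt; omega⟩)⁻¹ *
    (braidGen (n := 2 * k + 2) ⟨(a : ℕ), by have := a.isLt; omega⟩)⁻¹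
  else braidGen (n := 2 * k + 2) ⟨(a : ℕ) + 2, by have := a.isLt; omega⟩


/-- The moves M2 and M6' on the disjoint union `⨆_k B_{2k}` (the component `k` of the
sigma type is `B_{2k}`), relative to a family `ι` of standard inclusions
`B_{2k} → B_{2k+2}`.  M2: multiply `b ∈ B_{2k}` on the left or right by
`σ_{2i} σ_{2i+1} σ_{2i-1} σ_{2i}` (1-indexed, `1 ≤ i ≤ k-1`).  M6': replace `b ∈ B_{2k}`
by `ι(b) σ_{2k} ∈ B_{2k+2}`. -/
inductive PlatMoveM (ι : ∀ k : ℕ, BraidGroup (2 * k) →* BraidGroup (2 * k + 2)) :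
    (Σ k : ℕ, BraidGroup (2 * k)) → (Σ k : ℕ, BraidGroup (2 * k)) → Prop
  | m2_left (k i : ℕ) (hk : 1 ≤ k) (hi1 : 1 ≤ i) (hi2 : i ≤ k - 1) (b : BraidGroup (2 * k)) :
      PlatMoveM ι ⟨k, b⟩
        ⟨k, (braidGen ⟨2 * i - 1, by omega⟩ * braidGen ⟨2 * i, by omega⟩ *
             braidGen ⟨2 * i - 2, by omega⟩ * braidGen ⟨2 * i - 1, by omega⟩) * b⟩
  | m2_right (k i : ℕ) (hk : 1 ≤ k) (hi1 : 1 ≤ i) (hi2 : i ≤ k - 1) (b : BraidGroup (2 * k)) :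
      PlatMoveM ι ⟨k, b⟩
        ⟨k, b * (braidGen ⟨2 * i - 1, by omega⟩ * braidGen ⟨2 * i, by omega⟩ *
             braidGen ⟨2 * i - 2, by omega⟩ * braidGen ⟨2 * i - 1, by omega⟩)⟩
  | m6' (k : ℕ) (hk : 1 ≤ k) (b : BraidGroup (2 * k)) :
      PlatMoveM ι ⟨k, b⟩
        ⟨k + 1, ι k b * braidGen (n := 2 * k + 2) ⟨2 * k - 1, by omega⟩⟩

section GroupWords

variable {G : Type*} [Group G] {z a b c d e : G}

/-- Conjugation by the pair swap `c d b c` turns `a b c b⁻¹ a⁻¹` into `a`. -/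
theorem pairSwap_conj_left (hab : a * b * a = b * a * b) (hbc : b * c * b = c * b * c)
    (hac : Commute a c) (had : Commute a d) :
    (c * d * b * c) * (a * b * c * b⁻¹ * a⁻¹) * (c * d * b * c)⁻¹ = a := by
  have key : (c * d * b * c) * (a * b * c) = a * (c * d * b * c) * (a * b) := by
    calc _ = c * d * b * (c * a) * b * c := by simp only [mul_assoc]
      _ = c * d * (b * a * (c * b * c)) := by rw [← hac.eq]; simp only [mul_assoc]
      _ = c * d * (b * a * b) * c * b := by rw [← hbc]; simp only [mul_assoc]
      _ = c * (d * a) * b * (a * c) * b := by rw [← hab]; simp only [mul_assoc]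
      _ = (c * a) * d * b * c * a * b := by rw [← had.eq, hac.eq]; simp only [mul_assoc]
      _ = _ := by rw [← hac.eq]; simp only [mul_assoc]
  calc _ = ((c * d * b * c) * (a * b * c)) * (a * b)⁻¹ * (c * d * b * c)⁻¹ := by group
    _ = a := by rw [key]; group

/-- The pair swap `c d b c` conjugates `d` to `b`. -/
theorem pairSwap_conj_right (hbc : b * c * b = c * b * c) (hcd : c * d * c = d * c * d)
    (hbd : Commute b d) :
    (c * d * b * c) * d * (c * d * b * c)⁻¹ = b := by
  rw [mul_inv_eq_iff_eq_mul]
  calc _ = c * (d * b) * c * d := by simp only [mul_assoc]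
    _ = c * b * (d * c * d) := by rw [← hbd.eq]; simp only [mul_assoc]
    _ = (c * b * c) * d * c := by rw [← hcd]; simp only [mul_assoc]
    _ = b * c * (b * d) * c := by rw [← hbc]; simp only [mul_assoc]
    _ = _ := by rw [hbd.eq]; simp only [mul_assoc]

/-- Conjugation by the pair swap `c d b c` turns `e` into `c d e d⁻¹ c⁻¹`. -/
theorem pairSwap_conj_beyond (hbe : Commute b e) (hce : Commute c e) :
    (c * d * b * c) * e * (c * d * b * c)⁻¹ = c * d * e * d⁻¹ * c⁻¹ := by
  have key : b * c * e = e * (b * c) := (hbe.mul_left hce).eq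
  calc _ = c * d * (b * c * e) * (b * c)⁻¹ * d⁻¹ * c⁻¹ := by group
    _ = _ := by rw [key]; group

/-- Conjugating the generators next to two adjacent pair swaps gives the same element. -/
theorem pairSwap_conj_eq_adjacent (hab : a * b * a = b * a * b) (hbc : b * c * b = c * b * c)
    (hac : Commute a c) (had : Commute a d) (hbd : Commute b d)
    (hzb : Commute z b) (hzc : Commute z c) :
    (c * d * b * c) * a * (c * d * b * c)⁻¹ = (a * b * z * a)⁻¹ * c * (a * b * z * a) := by
  have key : b * a * c * b * a = c * b * a * c * b := by
    calc _ = b * (a * c) * b * a := by simp only [mul_assoc]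
      _ = b * c * (a * b * a) := by rw [hac.eq]; simp only [mul_assoc]
      _ = (b * c * b) * a * b := by rw [hab]; simp only [mul_assoc]
      _ = c * b * (c * a) * b := by rw [hbc]; simp only [mul_assoc]
      _ = _ := by rw [← hac.eq]; simp only [mul_assoc]
  have hl : (c * d * b * c) * a * (c * d * b * c)⁻¹ = (c * b) * a * (c * b)⁻¹ := by
    have hd : d * c * a = a * (d * c) := (had.mul_right hac).symm.eq
    calc _ = c * (d * b) * c * a * (c * (d * b) * c)⁻¹ := by group
      _ = c * b * (d * c * a) * (d * c)⁻¹ * (c * b)⁻¹ := by rw [← hbd.eq]; group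
      _ = _ := by rw [hd]; group
  have hr : (a * b * z * a)⁻¹ * c * (a * b * z * a) = (b * a)⁻¹ * c * (b * a) := by
    have hz : a * z * c = c * (a * z) := (hac.mul_left hzc).eq
    calc _ = (a * (b * z) * a)⁻¹ * c * (a * (b * z) * a) := by group
      _ = (b * a)⁻¹ * (a * z)⁻¹ * (c * (a * z)) * (b * a) := by rw [← hzb.eq]; group
      _ = _ := by rw [← hz]; group
  rw [hl, hr]
  calc _ = (b * a)⁻¹ * (b * a * c * b * a) * (c * b)⁻¹ := by group
    _ = _ := by rw [key]; group

end GroupWords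

namespace BraidGroup

/-- The generator with 0-based index `i`, with value `1` when `i` is out of range. -/
noncomputable def gen (n i : ℕ) : BraidGroup n :=
  if h : i < n - 1 then braidGen ⟨i, h⟩ else 1

theorem braidGen_mk {n i : ℕ} (h : i < n - 1) :
    (braidGen ⟨i, h⟩ : BraidGroup n) = gen n i := by
  rw [gen, dif_pos h]

theorem gen_braid {n i : ℕ} (h : i + 1 < n - 1) :
    gen n i * gen n (i + 1) * gen n i = gen n (i + 1) * gen n i * gen n (i + 1) := by
  have h' : i < n - 1 := by omega
  rw [← braidGen_mk h, ← braidGen_mk h']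
  exact PresentedGroup.mk_eq_mk_of_mul_inv_mem (Or.inl ⟨⟨i, h'⟩, ⟨i + 1, h⟩, rfl, rfl⟩)

theorem gen_commute {n i j : ℕ} (hij : i + 2 ≤ j ∨ j + 2 ≤ i) :
    Commute (gen n i) (gen n j) := by
  wlog h : i + 2 ≤ j generalizing i j
  · exact (this hij.symm (by omega)).symm
  by_cases hj : j < n - 1
  · have hi : i < n - 1 := by omega
    rw [← braidGen_mk hj, ← braidGen_mk hi]
    exact PresentedGroup.mk_eq_mk_of_mul_inv_mem (Or.inr ⟨⟨i, hi⟩, ⟨j, hj⟩, h, rfl⟩)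
  · simp [gen, hj]

/-- The element passing the strands `2p, 2p+1` past the strands `2p+2, 2p+3` (0-based). -/
noncomputable def pairSwap (n p : ℕ) : BraidGroup n :=
  gen n (2 * p + 1) * gen n (2 * p + 2) * gen n (2 * p) * gen n (2 * p + 1)

/-- The image of the generator `a` under the map inserting two strands after position
`2p + 1` (0-based). -/
noncomputable def stabGen (k p a : ℕ) : BraidGroup (2 * k + 2) :=
  if a < 2 * p + 1 then gen _ a
  else if a = 2 * p + 1 then
    gen _ (2 * p + 1) * gen _ (2 * p + 2) * gen _ (2 * p + 3) * (gen _ (2 * p + 2))⁻¹ *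
      (gen _ (2 * p + 1))⁻¹
  else gen _ (a + 2)

theorem TjGen_succ {k p a : ℕ} (h : a < 2 * k - 1) :
    TjGen k (p + 1) ⟨a, h⟩ = stabGen k p a := by
  have h1 : a + 1 < 2 * (p + 1) ↔ a < 2 * p + 1 := by omega
  have h2 : a + 1 = 2 * (p + 1) ↔ a = 2 * p + 1 := by omega
  simp only [TjGen, stabGen, braidGen_mk, h1, h2, dite_eq_ite]
  split_ifs with _ ha
  · rfl
  · subst ha; rfl
  · rfl

/-- Conjugation by a pair swap takes the `p`-th stabilization to the `(p + 1)`-st. -/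
theorem pairSwap_conj_stabGen {k p a : ℕ} (hp : p + 1 < k) (ha : a < 2 * k - 1) :
    pairSwap (2 * k + 2) (p + 1) * stabGen k p a * (pairSwap (2 * k + 2) (p + 1))⁻¹ =
      stabGen k (p + 1) a := by
  have e1 : 2 * (p + 1) = 2 * p + 2 := by ring
  simp only [pairSwap, stabGen, e1]
  rcases lt_or_ge a (2 * p + 1) with h | h
  · rw [if_pos h, if_pos (by omega), mul_inv_eq_iff_eq_mul]
    exact ((((gen_commute (by omega)).mul_right (gen_commute (by omega))).mul_right
      (gen_commute (by omega))).mul_right (gen_commute (by omega))).symm.eq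
  obtain ⟨s, rfl⟩ := Nat.exists_eq_add_of_le h
  match s with
  | 0 =>
    simp only [add_zero, lt_self_iff_false, if_false, if_true]
    rw [if_pos (by omega)]
    exact pairSwap_conj_left (gen_braid (by omega)) (gen_braid (by omega))
      (gen_commute (by omega)) (gen_commute (by omega))
  | 1 =>
    rw [if_neg (by omega), if_neg (by omega), if_pos (by omega)]
    exact pairSwap_conj_right (gen_braid (by omega)) (gen_braid (by omega))
      (gen_commute (by omega))
  | 2 =>
    rw [if_neg (by omega), if_neg (by omega), if_neg (by omega), if_pos (by omega)]
    exact pairSwap_conj_beyond (gen_commute (by omega)) (gen_commute (by omega))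
  | s + 3 =>
    rw [if_neg (by omega), if_neg (by omega), if_neg (by omega), if_neg (by omega),
      mul_inv_eq_iff_eq_mul]
    exact (((gen_commute (by omega)).mul_left (gen_commute (by omega))).mul_left
      (gen_commute (by omega))).mul_left (gen_commute (by omega)) |>.eq

theorem pairSwap_conj_gen {n p : ℕ} (hp : 2 * p + 3 < n - 1) :
    pairSwap n (p + 1) * gen n (2 * p + 1) * (pairSwap n (p + 1))⁻¹ =
      (pairSwap n p)⁻¹ * gen n (2 * p + 3) * pairSwap n p :=
  pairSwap_conj_eq_adjacent (gen_braid (by omega)) (gen_braid (by omega))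
    (gen_commute (by omega)) (gen_commute (by omega)) (gen_commute (by omega))
    (gen_commute (by omega)) (gen_commute (by omega))

theorem hom_ext {n : ℕ} {G : Type*} [Group G] {f g : BraidGroup n →* G}
    (h : ∀ a, f (braidGen a) = g (braidGen a)) : f = g :=
  PresentedGroup.ext h

section Moves

variable {ι : ∀ k : ℕ, BraidGroup (2 * k) →* BraidGroup (2 * k + 2)}

theorem eqvGen_pairSwap_mul {k p : ℕ} (hp : p + 1 < k) (b : BraidGroup (2 * k)) :
    Relation.EqvGen (PlatMoveM ι) ⟨k, b⟩ ⟨k, pairSwap (2 * k) p * b⟩ := by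
  have h := PlatMoveM.m2_left (ι := ι) k (p + 1) (by omega) (by omega) (by omega) b
  simp only [braidGen_mk] at h
  exact .rel _ _ h

theorem eqvGen_mul_pairSwap {k p : ℕ} (hp : p + 1 < k) (b : BraidGroup (2 * k)) :
    Relation.EqvGen (PlatMoveM ι) ⟨k, b⟩ ⟨k, b * pairSwap (2 * k) p⟩ := by
  have h := PlatMoveM.m2_right (ι := ι) k (p + 1) (by omega) (by omega) (by omega) b
  simp only [braidGen_mk] at h
  exact .rel _ _ h

theorem eqvGen_conj_pairSwap {k p : ℕ} (hp : p + 1 < k) (b : BraidGroup (2 * k)) :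
    Relation.EqvGen (PlatMoveM ι) ⟨k, b⟩
      ⟨k, pairSwap (2 * k) p * b * (pairSwap (2 * k) p)⁻¹⟩ := by
  refine (eqvGen_pairSwap_mul hp b).trans _ _ _ (.symm _ _ ?_)
  simpa using eqvGen_mul_pairSwap (ι := ι) hp
    (pairSwap (2 * k) p * b * (pairSwap (2 * k) p)⁻¹)

/-- Stabilizing at any position is a consequence of stabilizing at the last one, by downward
induction on the position. -/
theorem eqvGen_stab_mul_gen
    (hι : ∀ (k : ℕ) (a : Fin (2 * k - 1)), ι k (braidGen a) = gen (2 * k + 2) a)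
    (d k p : ℕ) (hk : k = p + 1 + d) (T : BraidGroup (2 * k) →* BraidGroup (2 * k + 2))
    (hT : ∀ a (h : a < 2 * k - 1), T (braidGen ⟨a, h⟩) = stabGen k p a)
    (b : BraidGroup (2 * k)) :
    Relation.EqvGen (PlatMoveM ι)
      ⟨k + 1, T b * gen (2 * k + 2) (2 * p + 1)⟩ ⟨k, b⟩ := by
  induction d generalizing p T b with
  | zero =>
    have hTι : T = ι k := hom_ext fun ⟨a, ha⟩ => by
      rw [hT, hι, stabGen, if_pos (by omega)]
    have h := PlatMoveM.m6' (ι := ι) k (by omega) b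
    rw [braidGen_mk, show 2 * k - 1 = 2 * p + 1 by omega] at h
    rw [hTι]
    exact .symm _ _ (.rel _ _ h)
  | succ d ih =>
    let m : BraidGroup (2 * k + 2) := pairSwap (2 * k + 2) (p + 1)
    let w : BraidGroup (2 * k + 2) := pairSwap (2 * k + 2) p
    let T' : BraidGroup (2 * k) →* BraidGroup (2 * k + 2) :=
      (MulAut.conj m).toMonoidHom.comp T
    have hT' : ∀ a (h : a < 2 * k - 1), T' (braidGen ⟨a, h⟩) = stabGen k (p + 1) a := by
      intro a h
      rw [← pairSwap_conj_stabGen (by omega) h, ← hT a h]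
      rfl
    have hgen : ∀ a < 2 * p + 3, T' (gen (2 * k) a) = gen (2 * k + 2) a := by
      intro a ha
      rw [← braidGen_mk (by omega), hT' a (by omega), stabGen, if_pos (by omega)]
    have hw : T' (pairSwap (2 * k) p) = w := by
      simp only [w, pairSwap, map_mul]
      rw [hgen _ (by omega), hgen _ (by omega), hgen _ (by omega)]
    have h1 := eqvGen_conj_pairSwap (ι := ι) (k := k + 1) (p := p + 1) (by omega)
      (T b * gen (2 * k + 2) (2 * p + 1))
    have h2 := eqvGen_conj_pairSwap (ι := ι) (k := k + 1) (p := p) (by omega)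
      (T' b * (w⁻¹ * gen (2 * k + 2) (2 * p + 3) * w))
    have h3 := ih (p + 1) (by omega) T' hT' (pairSwap (2 * k) p * b * (pairSwap (2 * k) p)⁻¹)
    have h4 := eqvGen_conj_pairSwap (ι := ι) (k := k) (p := p) (by omega) b
    have e1 : m * (T b * gen (2 * k + 2) (2 * p + 1)) * m⁻¹ =
        T' b * (w⁻¹ * gen (2 * k + 2) (2 * p + 3) * w) := by
      rw [← pairSwap_conj_gen (by omega)]
      change _ = m * T b * m⁻¹ * (m * _ * m⁻¹)
      group
    have e2 : w * (T' b * (w⁻¹ * gen (2 * k + 2) (2 * p + 3) * w)) * w⁻¹ =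
        T' (pairSwap (2 * k) p * b * (pairSwap (2 * k) p)⁻¹) * gen (2 * k + 2) (2 * p + 3) := by
      rw [map_mul, map_mul, map_inv, hw]
      group
    refine h1.trans _ _ _ (.trans _ _ _ ?_ (h3.trans _ _ _ (h4.symm)))
    change Relation.EqvGen (PlatMoveM ι)
      ⟨k + 1, m * (T b * gen (2 * k + 2) (2 * p + 1)) * m⁻¹⟩ _
    rw [e1]
    change Relation.EqvGen (PlatMoveM ι) _
      ⟨k + 1, w * (T' b * (w⁻¹ * gen (2 * k + 2) (2 * p + 3) * w)) * w⁻¹⟩ at h2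
    rw [e2] at h2
    exact h2

end Moves

end BraidGroup

/-- Lemma 2.2: for `b ∈ B_{2k}` and `1 ≤ j ≤ k`, the element `T_j(b) σ_{2j} ∈ B_{2k+2}`
is related to `b` by the equivalence relation generated by the moves M2 and M6'; i.e.
Birman's move M6 is a consequence of M6' and M2. -/
theorem M6_from_M6'_and_M2
    (ι : ∀ k : ℕ, BraidGroup (2 * k) →* BraidGroup (2 * k + 2))
    (hι : ∀ (k : ℕ) (a : Fin (2 * k - 1)),
      ι k (braidGen a) = braidGen (n := 2 * k + 2) ⟨(a : ℕ), by have := a.isLt; omega⟩)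
    (k j : ℕ) (hk : 1 ≤ k) (hj1 : 1 ≤ j) (hjk : j ≤ k)
    (b : BraidGroup (2 * k))
    (T : BraidGroup (2 * k) →* BraidGroup (2 * k + 2))
    (hT : ∀ a : Fin (2 * k - 1), T (braidGen a) = TjGen k j a) :
    Relation.EqvGen (PlatMoveM ι)
      ⟨k + 1, T b * braidGen (n := 2 * k + 2) ⟨2 * j - 1, by omega⟩⟩ ⟨k, b⟩ := by
  obtain ⟨p, rfl⟩ : ∃ p, j = p + 1 := ⟨j - 1, by omega⟩
  have hT' : ∀ a (h : a < 2 * k - 1), T (braidGen ⟨a, h⟩) = BraidGroup.stabGen k p a :=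
    fun a h => (hT ⟨a, h⟩).trans (BraidGroup.TjGen_succ h)
  have := BraidGroup.eqvGen_stab_mul_gen
    (fun k a => (hι k a).trans (BraidGroup.braidGen_mk _)) (k - (p + 1)) k p (by omega) T hT' b
  rw [BraidGroup.braidGen_mk]
  exact this
end

section
/- Consider the disjoint union ⨆_{k ≥ 1} B_{2k}. Let ≈_M be the equivalence relation generated by the moves: (M1) σ_1 b ≈ b and b σ_1 ≈ b for b ∈ B_{2k}; (M2) (σ_{2i} σ_{2i+1} σ_{2i-1} σ_{2i}) b ≈ b and b (σ_{2i} σ_{2i+1} σ_{2i-1} σ_{2i}) ≈ b for b ∈ B_{2k}, 1 ≤ i ≤ k-1; (M3) (σ_2 σ_1² σ_2) b ≈ b and b (σ_2 σ_1² σ_2) ≈ b for b ∈ B_{2k}; (M6') b ≈ ι(b) σ_{2k} for b ∈ B_{2k}. Let ≈_P be the equivalence relation generated by the same moves M1, M2, M3 together with (P4) b ≈ σ_{2k} ι(b) for b ∈ B_{2k}. Let φ̄ denote, on each B_{2k}, the involutive anti-automorphism fixing every generator σ_i (the reversal map). Then for all b_1 ∈ B_{2k_1} and b_2 ∈ B_{2k_2}: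 b_1 ≈_M b_2 if and only if φ̄(b_1) ≈_P φ̄(b_2). -/
/-- The moves M1, M2, M3, M6' on the disjoint union `⨆_k B_{2k}` (component `k` of the
sigma type is `B_{2k}`), relative to a family `ι` of standard inclusions
`B_{2k} → B_{2k+2}` (`σ_i ↦ σ_i`).  All braid-generator indices below are 1-indexed. -/
inductive MoveM (ι : ∀ k : ℕ, BraidGroup (2 * k) →* BraidGroup (2 * k + 2)) :
    (Σ k : ℕ, BraidGroup (2 * k)) → (Σ k : ℕ, BraidGroup (2 * k)) → Prop
  | m1_left (k : ℕ) (hk : 1 ≤ k) (b : BraidGroup (2 * k)) :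
      MoveM ι ⟨k, braidGen ⟨0, by omega⟩ * b⟩ ⟨k, b⟩
  | m1_right (k : ℕ) (hk : 1 ≤ k) (b : BraidGroup (2 * k)) :
      MoveM ι ⟨k, b * braidGen ⟨0, by omega⟩⟩ ⟨k, b⟩
  | m2_left (k i : ℕ) (hk : 1 ≤ k) (hi1 : 1 ≤ i) (hi2 : i ≤ k - 1) (b : BraidGroup (2 * k)) :
      MoveM ι ⟨k, (braidGen ⟨2 * i - 1, by omega⟩ * braidGen ⟨2 * i, by omega⟩ *
                   braidGen ⟨2 * i - 2, by omega⟩ * braidGen ⟨2 * i - 1, by omega⟩) * b⟩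
        ⟨k, b⟩
  | m2_right (k i : ℕ) (hk : 1 ≤ k) (hi1 : 1 ≤ i) (hi2 : i ≤ k - 1) (b : BraidGroup (2 * k)) :
      MoveM ι ⟨k, b * (braidGen ⟨2 * i - 1, by omega⟩ * braidGen ⟨2 * i, by omega⟩ *
                   braidGen ⟨2 * i - 2, by omega⟩ * braidGen ⟨2 * i - 1, by omega⟩)⟩
        ⟨k, b⟩
  | m3_left (k : ℕ) (hk : 2 ≤ k) (b : BraidGroup (2 * k)) :
      MoveM ι ⟨k, (braidGen ⟨1, by omega⟩ * braidGen ⟨0, by omega⟩ * braidGen ⟨0, by omega⟩ *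
                   braidGen ⟨1, by omega⟩) * b⟩ ⟨k, b⟩
  | m3_right (k : ℕ) (hk : 2 ≤ k) (b : BraidGroup (2 * k)) :
      MoveM ι ⟨k, b * (braidGen ⟨1, by omega⟩ * braidGen ⟨0, by omega⟩ * braidGen ⟨0, by omega⟩ *
                   braidGen ⟨1, by omega⟩)⟩ ⟨k, b⟩
  | m6' (k : ℕ) (hk : 1 ≤ k) (b : BraidGroup (2 * k)) :
      MoveM ι ⟨k, b⟩ ⟨k + 1, ι k b * braidGen (n := 2 * k + 2) ⟨2 * k - 1, by omega⟩⟩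

/-- The moves M1, M2, M3, P4 on the disjoint union `⨆_k B_{2k}`:
the same as `MoveM` except that M6' (`b ≈ ι(b) σ_{2k}`) is replaced by
P4 (`b ≈ σ_{2k} ι(b)`). -/
inductive MoveP (ι : ∀ k : ℕ, BraidGroup (2 * k) →* BraidGroup (2 * k + 2)) :
    (Σ k : ℕ, BraidGroup (2 * k)) → (Σ k : ℕ, BraidGroup (2 * k)) → Prop
  | m1_left (k : ℕ) (hk : 1 ≤ k) (b : BraidGroup (2 * k)) :
      MoveP ι ⟨k, braidGen ⟨0, by omega⟩ * b⟩ ⟨k, b⟩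
  | m1_right (k : ℕ) (hk : 1 ≤ k) (b : BraidGroup (2 * k)) :
      MoveP ι ⟨k, b * braidGen ⟨0, by omega⟩⟩ ⟨k, b⟩
  | m2_left (k i : ℕ) (hk : 1 ≤ k) (hi1 : 1 ≤ i) (hi2 : i ≤ k - 1) (b : BraidGroup (2 * k)) :
      MoveP ι ⟨k, (braidGen ⟨2 * i - 1, by omega⟩ * braidGen ⟨2 * i, by omega⟩ *
                   braidGen ⟨2 * i - 2, by omega⟩ * braidGen ⟨2 * i - 1, by omega⟩) * b⟩
        ⟨k, b⟩
  | m2_right (k i : ℕ) (hk : 1 ≤ k) (hi1 : 1 ≤ i) (hi2 : i ≤ k - 1) (b : BraidGroup (2 * k)) :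
      MoveP ι ⟨k, b * (braidGen ⟨2 * i - 1, by omega⟩ * braidGen ⟨2 * i, by omega⟩ *
                   braidGen ⟨2 * i - 2, by omega⟩ * braidGen ⟨2 * i - 1, by omega⟩)⟩
        ⟨k, b⟩
  | m3_left (k : ℕ) (hk : 2 ≤ k) (b : BraidGroup (2 * k)) :
      MoveP ι ⟨k, (braidGen ⟨1, by omega⟩ * braidGen ⟨0, by omega⟩ * braidGen ⟨0, by omega⟩ *
                   braidGen ⟨1, by omega⟩) * b⟩ ⟨k, b⟩
  | m3_right (k : ℕ) (hk : 2 ≤ k) (b : BraidGroup (2 * k)) :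
      MoveP ι ⟨k, b * (braidGen ⟨1, by omega⟩ * braidGen ⟨0, by omega⟩ * braidGen ⟨0, by omega⟩ *
                   braidGen ⟨1, by omega⟩)⟩ ⟨k, b⟩
  | p4 (k : ℕ) (hk : 1 ≤ k) (b : BraidGroup (2 * k)) :
      MoveP ι ⟨k, b⟩ ⟨k + 1, braidGen (n := 2 * k + 2) ⟨2 * k - 1, by omega⟩ * ι k b⟩

theorem braidGen_commute {n : ℕ} (i j : Fin (n - 1)) (h : (i : ℕ) + 2 ≤ j) :
    (braidGen i * braidGen j : BraidGroup n) = braidGen j * braidGen i := by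
  have hr := PresentedGroup.one_of_mem (rels := braidRels (n - 1)) (Or.inr ⟨i, j, h, rfl⟩)
  rw [map_mul, map_inv, mul_inv_eq_one] at hr
  exact hr

theorem BraidGroup.hom_ext_s8 {n : ℕ} {G : Type*} [Group G] {f g : BraidGroup n →* G}
    (h : ∀ i, f (braidGen i) = g (braidGen i)) : f = g :=
  PresentedGroup.ext (rels := braidRels (n - 1)) h

/-- Anti-multiplicative maps fixing the generators are compatible with a homomorphism that
sends generators to fixed elements. -/
theorem reversal_comp_hom {n m : ℕ} (f : BraidGroup n →* BraidGroup m)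
    (φ : BraidGroup n → BraidGroup n) (ψ : BraidGroup m → BraidGroup m)
    (hφ : ∀ a b, φ (a * b) = φ b * φ a) (hψ : ∀ a b, ψ (a * b) = ψ b * ψ a)
    (hφ_gen : ∀ i, φ (braidGen i) = braidGen i)
    (hψ_gen : ∀ i, ψ (f (braidGen i)) = f (braidGen i)) (x : BraidGroup n) :
    ψ (f x) = f (φ x) := by
  let F : BraidGroup n →* (BraidGroup m)ᵐᵒᵖ :=
    MonoidHom.mk' (fun x => MulOpposite.op (ψ (f x))) fun a b => by simp [hψ]
  let H : BraidGroup n →* (BraidGroup m)ᵐᵒᵖ :=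
    MonoidHom.mk' (fun x => MulOpposite.op (f (φ x))) fun a b => by simp [hφ]
  have hFH : F = H := BraidGroup.hom_ext_s8 fun i => by simp [F, H, hφ_gen, hψ_gen]
  exact MulOpposite.op_injective (DFunLike.congr_fun hFH x)

/-- Proposition 2.1 (combinatorial content): with `φ̄` the reversal anti-automorphism of
each `B_{2k}` (the involutive anti-automorphism fixing every generator `σ_i`), two braids
`b_1 ∈ B_{2k_1}`, `b_2 ∈ B_{2k_2}` are related by the equivalence relation generated by
the moves M1, M2, M3, M6' iff `φ̄(b_1)`, `φ̄(b_2)` are related by the equivalence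
relation generated by M1, M2, M3, P4. -/
theorem movesM_iff_movesP
    (ι : ∀ k : ℕ, BraidGroup (2 * k) →* BraidGroup (2 * k + 2))
    (hι : ∀ (k : ℕ) (a : Fin (2 * k - 1)),
      ι k (braidGen a) = braidGen (n := 2 * k + 2) ⟨(a : ℕ), by have := a.isLt; omega⟩)
    (φ : ∀ k : ℕ, BraidGroup (2 * k) → BraidGroup (2 * k))
    (hφ_anti : ∀ (k : ℕ) (a b : BraidGroup (2 * k)), φ k (a * b) = φ k b * φ k a)
    (hφ_gen : ∀ (k : ℕ) (i : Fin (2 * k - 1)), φ k (braidGen i) = braidGen i)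
    (hφ_invol : ∀ (k : ℕ) (x : BraidGroup (2 * k)), φ k (φ k x) = x)
    (k₁ k₂ : ℕ) (hk₁ : 1 ≤ k₁) (hk₂ : 1 ≤ k₂)
    (b₁ : BraidGroup (2 * k₁)) (b₂ : BraidGroup (2 * k₂)) :
    Relation.EqvGen (MoveM ι) ⟨k₁, b₁⟩ ⟨k₂, b₂⟩ ↔
      Relation.EqvGen (MoveP ι) ⟨k₁, φ k₁ b₁⟩ ⟨k₂, φ k₂ b₂⟩ := by
  have hφι (k : ℕ) (b : BraidGroup (2 * k)) :
      φ (k + 1) (ι k b) = ι k (φ k b) :=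
    reversal_comp_hom (ι k) (φ k) (φ (k + 1)) (hφ_anti k) (hφ_anti (k + 1)) (hφ_gen k)
      (fun i => by rw [hι]; exact hφ_gen (k + 1) _) b
  have hφ_m2 (k i : ℕ) (hi1 : 1 ≤ i) (hi2 : i ≤ k - 1) :
      φ k (braidGen ⟨2 * i - 1, by omega⟩ * braidGen ⟨2 * i, by omega⟩ *
          braidGen ⟨2 * i - 2, by omega⟩ * braidGen ⟨2 * i - 1, by omega⟩) =
        braidGen ⟨2 * i - 1, by omega⟩ * braidGen ⟨2 * i, by omega⟩ *
          braidGen ⟨2 * i - 2, by omega⟩ * braidGen ⟨2 * i - 1, by omega⟩ := by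
    have hcomm := braidGen_commute (n := 2 * k) ⟨2 * i - 2, by omega⟩ ⟨2 * i, by omega⟩
      (by simp only; omega)
    simp only [hφ_anti, hφ_gen, mul_assoc]
    rw [← mul_assoc (braidGen ⟨2 * i - 2, _⟩), hcomm, mul_assoc]
  have hφ_m3 (k : ℕ) (hk : 2 ≤ k) :
      φ k (braidGen ⟨1, by omega⟩ * braidGen ⟨0, by omega⟩ * braidGen ⟨0, by omega⟩ *
          braidGen ⟨1, by omega⟩) =
        braidGen ⟨1, by omega⟩ * braidGen ⟨0, by omega⟩ * braidGen ⟨0, by omega⟩ *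
          braidGen ⟨1, by omega⟩ := by
    simp only [hφ_anti, hφ_gen, mul_assoc]
  let Φ : (Σ k : ℕ, BraidGroup (2 * k)) → (Σ k : ℕ, BraidGroup (2 * k)) := Sigma.map id φ
  have hΦ (x) : Φ (Φ x) = x := by simp [Φ, Sigma.map, hφ_invol]
  have hMP {x y} (h : MoveM ι x y) : MoveP ι (Φ x) (Φ y) := by
    cases h with
    | m1_left k hk b =>
      simp only [Φ, Sigma.map, id, hφ_anti, hφ_gen]
      exact .m1_right k hk _
    | m1_right k hk b =>
      simp only [Φ, Sigma.map, id, hφ_anti, hφ_gen]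
      exact .m1_left k hk _
    | m2_left k i hk hi1 hi2 b =>
      simp only [Φ, Sigma.map, id, hφ_anti k _ b, hφ_m2 k i hi1 hi2]
      exact .m2_right k i hk hi1 hi2 _
    | m2_right k i hk hi1 hi2 b =>
      simp only [Φ, Sigma.map, id, hφ_anti k b, hφ_m2 k i hi1 hi2]
      exact .m2_left k i hk hi1 hi2 _
    | m3_left k hk b =>
      simp only [Φ, Sigma.map, id, hφ_anti k _ b, hφ_m3 k hk]
      exact .m3_right k hk _
    | m3_right k hk b =>
      simp only [Φ, Sigma.map, id, hφ_anti k b, hφ_m3 k hk]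
      exact .m3_left k hk _
    | m6' k hk b =>
      have h : φ (k + 1) (ι k b * braidGen (n := 2 * k + 2) ⟨2 * k - 1, by omega⟩) =
          braidGen (n := 2 * k + 2) ⟨2 * k - 1, by omega⟩ * ι k (φ k b) := by
        rw [← hφι]
        exact (hφ_anti (k + 1) _ _).trans (congrArg (· * _) (hφ_gen (k + 1) _))
      simp only [Φ, Sigma.map, id, h]
      exact .p4 k hk _
  have hPM {x y} (h : MoveP ι x y) : MoveM ι (Φ x) (Φ y) := by
    cases h with
    | m1_left k hk b =>
      simp only [Φ, Sigma.map, id, hφ_anti, hφ_gen]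
      exact .m1_right k hk _
    | m1_right k hk b =>
      simp only [Φ, Sigma.map, id, hφ_anti, hφ_gen]
      exact .m1_left k hk _
    | m2_left k i hk hi1 hi2 b =>
      simp only [Φ, Sigma.map, id, hφ_anti k _ b, hφ_m2 k i hi1 hi2]
      exact .m2_right k i hk hi1 hi2 _
    | m2_right k i hk hi1 hi2 b =>
      simp only [Φ, Sigma.map, id, hφ_anti k b, hφ_m2 k i hi1 hi2]
      exact .m2_left k i hk hi1 hi2 _
    | m3_left k hk b =>
      simp only [Φ, Sigma.map, id, hφ_anti k _ b, hφ_m3 k hk]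
      exact .m3_right k hk _
    | m3_right k hk b =>
      simp only [Φ, Sigma.map, id, hφ_anti k b, hφ_m3 k hk]
      exact .m3_left k hk _
    | p4 k hk b =>
      have h : φ (k + 1) (braidGen (n := 2 * k + 2) ⟨2 * k - 1, by omega⟩ * ι k b) =
          ι k (φ k b) * braidGen (n := 2 * k + 2) ⟨2 * k - 1, by omega⟩ := by
        rw [← hφι]
        exact (hφ_anti (k + 1) _ _).trans (congrArg (_ * ·) (hφ_gen (k + 1) _))
      simp only [Φ, Sigma.map, id, h]
      exact .m6' k hk _
  have map_eqvGen {r s : (Σ k : ℕ, BraidGroup (2 * k)) → (Σ k : ℕ, BraidGroup (2 * k)) → Prop}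
      (hrs : ∀ x y, r x y → s (Φ x) (Φ y)) {x y} (h : Relation.EqvGen r x y) :
      Relation.EqvGen s (Φ x) (Φ y) := by
    induction h with
    | rel x y h => exact .rel _ _ (hrs x y h)
    | refl x => exact .refl _
    | symm x y _ ih => exact .symm _ _ ih
    | trans x y z _ _ ih₁ ih₂ => exact .trans _ _ _ ih₁ ih₂
  refine ⟨fun h => map_eqvGen (fun _ _ => hMP) h, fun h => ?_⟩
  rw [← hΦ ⟨k₁, b₁⟩, ← hΦ ⟨k₂, b₂⟩]
  exact map_eqvGen (fun _ _ => hPM) h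
end
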